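/- Let n ≥ 1. For every ℓ with 1 ≤ ℓ ≤ n, every A ⊆ {1,…,n}, and every 1 ≤ k ≤ n+1, the quantity m^ℓ_{A,k} equals the number of nonattacking placements of exactly ℓn kings on the 2ℓ×2n strip whose restriction to the top two rows is the placement S(A,k). -/

import Mathlib

/-- A placement of kings on an `m × n` board (positions 0-indexed) is nonattacking
if any two distinct positions are at Chebyshev distance at least 2. -/
def Nonattacking {m n : ℕ} (S : Finset (Fin m × Fin n)) : Prop :=
  ∀ p ∈ S, ∀ q ∈ S, p ≠ q →
    2 ≤ max (Nat.dist (p.1 : ℕ) (q.1 : ℕ)) (Nat.dist (p.2 : ℕ) (q.2 : ℕ))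

/-- Membership predicate for the placement `S(A,k)` on the `2 × 2n` strip:
one king in each 2×2 block `i` (1-indexed; its 0-indexed columns are `2i-2` (left)
and `2i-1` (right)): in the top row (row 0) if `i ∈ A`, the bottom row (row 1)
otherwise; in the left column of its block if `i < k`, the right column if `i ≥ k`. -/
def kingPred (n : ℕ) (A : Finset ℕ) (k : ℕ) (p : Fin 2 × Fin (2 * n)) : Prop :=
  ∃ i ∈ Finset.Icc 1 n,
    (p.1 : ℕ) = (if i ∈ A then 0 else 1) ∧
    (p.2 : ℕ) = (if i < k then 2 * i - 2 else 2 * i - 1)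

instance (n : ℕ) (A : Finset ℕ) (k : ℕ) : DecidablePred (kingPred n A k) :=
  fun _ => by unfold kingPred; infer_instance

/-- The placement `S(A,k)` on the `2 × 2n` strip. -/
def kingPlacement (n : ℕ) (A : Finset ℕ) (k : ℕ) : Finset (Fin 2 × Fin (2 * n)) :=
  Finset.univ.filter (kingPred n A k)

/-- `p(A,B,k) = max({i ∈ {1,…,n+1} : i < k, i ∉ A, i−1 ∈ B} ∪ {1})`. -/
def pFun (n : ℕ) (A B : Finset ℕ) (k : ℕ) : ℕ :=
  (insert 1 ((Finset.Icc 1 (n + 1)).filter (fun i => i < k ∧ i ∉ A ∧ i - 1 ∈ B))).max'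
    (Finset.insert_nonempty _ _)

/-- `q(A,B,k) = min({i ∈ {1,…,n+1} : i > k, i ∈ B, i−1 ∉ A} ∪ {n+1})`. -/
def qFun (n : ℕ) (A B : Finset ℕ) (k : ℕ) : ℕ :=
  (insert (n + 1) ((Finset.Icc 1 (n + 1)).filter (fun i => k < i ∧ i ∈ B ∧ i - 1 ∉ A))).min'
    (Finset.insert_nonempty _ _)

/-- The matrix entries `m^ℓ_{A,k}`: `m^1_{A,k} = 1` and, for `ℓ > 1`,
`m^ℓ_{A,k} = Σ_{B ⊆ A} Σ_{i = p(A,B,k)}^{q(A,B,k)} m^{ℓ−1}_{B,i}`. -/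
def mEnt (n : ℕ) : ℕ → Finset ℕ → ℕ → ℕ
  | 0, _, _ => 0
  | 1, _, _ => 1
  | ℓ + 2, A, k =>
      ∑ B ∈ A.powerset, ∑ i ∈ Finset.Icc (pFun n A B k) (qFun n A B k), mEnt n (ℓ + 1) B i

/-- Coordinate form of membership of `(a, b)` in the placement `S(A,k)`. -/
def InRow (n : ℕ) (A : Finset ℕ) (k a b : ℕ) : Prop :=
  a < 2 ∧ b < 2 * n ∧ (a = 0 ↔ b / 2 + 1 ∈ A) ∧ (b % 2 = 0 ↔ b / 2 + 1 < k)

instance (n : ℕ) (A : Finset ℕ) (k a b : ℕ) : Decidable (InRow n A k a b) := by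
  unfold InRow; infer_instance

/-- Two kings at Chebyshev distance at most 1 coincide. -/
def Peaceful (S : Finset (ℕ × ℕ)) : Prop :=
  ∀ a b c d : ℕ, (a, b) ∈ S → (c, d) ∈ S →
    a ≤ c + 1 → c ≤ a + 1 → b ≤ d + 1 → d ≤ b + 1 → a = c ∧ b = d

/-- Nonattacking placements of `ℓ * n` kings on the `2ℓ × 2n` strip, as sets of pairs of natural
numbers, whose top two rows are `S(A,k)`. -/
def IsStripPlacement (n ℓ : ℕ) (A : Finset ℕ) (k : ℕ) (S : Finset (ℕ × ℕ)) : Prop :=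
  (∀ a b : ℕ, (a, b) ∈ S → a < 2 * ℓ ∧ b < 2 * n) ∧ Peaceful S ∧ S.card = ℓ * n ∧
    ∀ a b : ℕ, a < 2 → ((a, b) ∈ S ↔ InRow n A k a b)

open Classical in
/-- The finite set of all placements satisfying `IsStripPlacement`. -/
noncomputable def stripPlacements (n ℓ : ℕ) (A : Finset ℕ) (k : ℕ) : Finset (Finset (ℕ × ℕ)) :=
  (Finset.range (2 * ℓ) ×ˢ Finset.range (2 * n)).powerset.filter (IsStripPlacement n ℓ A k)

theorem mem_stripPlacements {n ℓ : ℕ} {A : Finset ℕ} {k : ℕ} {S : Finset (ℕ × ℕ)} :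
    S ∈ stripPlacements n ℓ A k ↔ IsStripPlacement n ℓ A k S := by
  simp only [stripPlacements, Finset.mem_filter, Finset.mem_powerset, and_iff_right_iff_imp]
  rintro h ⟨a, b⟩ hab
  simpa using h.1 a b hab

/-- The placement `S(A,k)` as a set of pairs of natural numbers. -/
def rowFinset (n : ℕ) (A : Finset ℕ) (k : ℕ) : Finset (ℕ × ℕ) :=
  (Finset.range 2 ×ˢ Finset.range (2 * n)).filter fun p => InRow n A k p.1 p.2

theorem mem_rowFinset {n : ℕ} {A : Finset ℕ} {k a b : ℕ} :
    (a, b) ∈ rowFinset n A k ↔ InRow n A k a b := by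
  simp only [rowFinset, Finset.mem_filter, Finset.mem_product, Finset.mem_range,
    and_iff_right_iff_imp]
  exact fun h => ⟨h.1, h.2.1⟩

theorem exists_inRow_block {n c : ℕ} (A : Finset ℕ) (k : ℕ) (hc : c < n) :
    ∃ a b, b / 2 = c ∧ InRow n A k a b := by
  have e : (2 * c + if c + 1 < k then 0 else 1) / 2 = c := by split_ifs <;> omega
  refine ⟨if c + 1 ∈ A then 0 else 1, 2 * c + if c + 1 < k then 0 else 1, e, ?_, ?_, ?_, ?_⟩
  · split_ifs <;> omega
  · split_ifs <;> omega
  · rw [e]; split_ifs with h <;> simp [h]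
  · rw [e]; split_ifs with h <;> omega

theorem card_rowFinset (n : ℕ) (A : Finset ℕ) (k : ℕ) : (rowFinset n A k).card = n := by
  conv_rhs => rw [← Finset.card_range n]
  refine Finset.card_bij (fun p _ => p.2 / 2) ?_ ?_ ?_
  · rintro ⟨a, b⟩ h
    obtain ⟨-, h, -⟩ := mem_rowFinset.1 h
    simp only [Finset.mem_range]
    omega
  · rintro ⟨a, b⟩ h ⟨a', b'⟩ h' e
    obtain ⟨h1, h2, h3, h4⟩ := mem_rowFinset.1 h
    obtain ⟨h1', h2', h3', h4'⟩ := mem_rowFinset.1 h'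
    simp only at e
    rw [← e] at h3' h4'
    rw [Prod.mk.injEq]
    by_cases hA : b / 2 + 1 ∈ A <;> simp only [hA, iff_true, iff_false] at h3 h3' <;> omega
  · intro i hi
    rw [Finset.mem_range] at hi
    obtain ⟨a, b, rfl, h⟩ := exists_inRow_block A k hi
    exact ⟨(a, b), mem_rowFinset.2 h, rfl⟩

theorem InRow.unique {n : ℕ} {A B : Finset ℕ} {k j : ℕ} (hA : A ⊆ Finset.Icc 1 n)
    (hB : B ⊆ Finset.Icc 1 n) (hk : k ∈ Finset.Icc 1 (n + 1)) (hj : j ∈ Finset.Icc 1 (n + 1))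
    (h : ∀ a b : ℕ, a < 2 → (InRow n A k a b ↔ InRow n B j a b)) : A = B ∧ k = j := by
  rw [Finset.mem_Icc] at hk hj
  have key : ∀ i, 1 ≤ i → i ≤ n → (i ∈ A ↔ i ∈ B) ∧ (i < k ↔ i < j) := by
    intro i hi hin
    obtain ⟨a, b, hb, hab⟩ := exists_inRow_block A k (show i - 1 < n by omega)
    obtain rfl : b / 2 + 1 = i := by omega
    obtain ⟨-, -, h3, h4⟩ := (h a b hab.1).1 hab
    exact ⟨hab.2.2.1.symm.trans h3, hab.2.2.2.symm.trans h4⟩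
  constructor
  · ext i
    constructor
    · intro hi
      have := Finset.mem_Icc.1 (hA hi)
      exact (key i this.1 this.2).1.1 hi
    · intro hi
      have := Finset.mem_Icc.1 (hB hi)
      exact (key i this.1 this.2).1.2 hi
  · by_contra hne
    rcases Nat.lt_or_gt_of_ne hne with hlt | hlt
    · have := (key k (by omega) (by omega)).2
      omega
    · have := (key j (by omega) (by omega)).2
      omega

/-- A maximum placement has a king in every `2 × 2` block. -/
theorem Peaceful.exists_mem_block {n ℓ : ℕ} {S : Finset (ℕ × ℕ)} (hS : Peaceful S)
    (hb : ∀ a b : ℕ, (a, b) ∈ S → a < 2 * ℓ ∧ b < 2 * n) (hc : S.card = ℓ * n)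
    {r c : ℕ} (hr : r < ℓ) (hc' : c < n) : ∃ a b, (a, b) ∈ S ∧ a / 2 = r ∧ b / 2 = c := by
  have hinj : Set.InjOn (fun p : ℕ × ℕ => (p.1 / 2, p.2 / 2)) S := by
    rintro ⟨a, b⟩ h ⟨a', b'⟩ h' e
    simp only [Prod.mk.injEq] at e
    obtain ⟨rfl, rfl⟩ := hS a b a' b' h h' (by omega) (by omega) (by omega) (by omega)
    rfl
  have himg : S.image (fun p : ℕ × ℕ => (p.1 / 2, p.2 / 2)) =
      Finset.range ℓ ×ˢ Finset.range n := by
    apply Finset.eq_of_subset_of_card_le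
    · rintro q hq
      obtain ⟨⟨a, b⟩, h, rfl⟩ := Finset.mem_image.1 hq
      have := hb a b h
      simp only [Finset.mem_product, Finset.mem_range]
      omega
    · rw [Finset.card_image_of_injOn hinj, hc]
      simp
  have hmem : (r, c) ∈ S.image (fun p : ℕ × ℕ => (p.1 / 2, p.2 / 2)) := by
    rw [himg]; simp [hr, hc']
  obtain ⟨⟨a, b⟩, h, e⟩ := Finset.mem_image.1 hmem
  simp only [Prod.mk.injEq] at e
  exact ⟨a, b, h, e⟩

/-- The top two rows of a maximum placement form some `S(B,j)`. -/
theorem Peaceful.exists_inRow {n : ℕ} {S : Finset (ℕ × ℕ)} (hS : Peaceful S)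
    (hb : ∀ a b : ℕ, (a, b) ∈ S → b < 2 * n)
    (hblock : ∀ c < n, ∃ a b, (a, b) ∈ S ∧ a < 2 ∧ b / 2 = c) :
    ∃ B ⊆ Finset.Icc 1 n, ∃ j ∈ Finset.Icc 1 (n + 1),
      ∀ a b : ℕ, a < 2 → ((a, b) ∈ S ↔ InRow n B j a b) := by
  choose! f g hfg hf hg using hblock
  have huniq : ∀ a b, a < 2 → (a, b) ∈ S → f (b / 2) = a ∧ g (b / 2) = b := by
    intro a b ha h
    have hbn := hb a b h
    have hc : b / 2 < n := by omega
    have h1 := hf _ hc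
    have h2 := hg _ hc
    exact hS _ _ _ _ (hfg _ hc) h (by omega) (by omega) (by omega) (by omega)
  have hex : ∃ i, n ≤ i ∨ g i % 2 = 1 := ⟨n, Or.inl le_rfl⟩
  classical
  have hright : ∀ i, Nat.find hex ≤ i → i < n → g i % 2 = 1 := by
    intro i hi
    induction i, hi using Nat.le_induction with
    | base => intro h; have := Nat.find_spec hex; omega
    | succ i hi ih =>
      intro h
      have h0 := ih (by omega)
      by_contra hne
      have h1 := hf i (by omega)
      have h2 := hf (i + 1) h
      have h3 := hg i (by omega)
      have h4 := hg (i + 1) h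
      have := hS _ _ _ _ (hfg i (by omega)) (hfg (i + 1) h) (by omega) (by omega) (by omega)
        (by omega)
      omega
  have hfind : Nat.find hex ≤ n := Nat.find_min' hex (Or.inl le_rfl)
  have hcol : ∀ i < n, (g i % 2 = 0 ↔ i + 1 < Nat.find hex + 1) := by
    intro i hi
    constructor
    · intro h
      by_contra hlt
      have := hright i (by omega) hi
      omega
    · intro h
      have := Nat.find_min hex (show i < Nat.find hex by omega)
      omega
  refine ⟨(Finset.Icc 1 n).filter (fun i => f (i - 1) = 0), Finset.filter_subset _ _,
    Nat.find hex + 1, Finset.mem_Icc.2 ⟨by omega, by omega⟩, fun a b ha => ?_⟩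
  simp only [InRow, Finset.mem_filter, Finset.mem_Icc, Nat.add_sub_cancel]
  constructor
  · intro h
    have hbn := hb a b h
    obtain ⟨h1, h2⟩ := huniq a b ha h
    have h3 := hcol (b / 2) (by omega)
    refine ⟨ha, hbn, ?_, ?_⟩ <;> omega
  · rintro ⟨-, hbn, h3, h4⟩
    have hc : b / 2 < n := by omega
    have h5 := hcol (b / 2) hc
    have h6 := hf _ hc
    have h7 := hg _ hc
    have h8 := hfg _ hc
    have e1 : f (b / 2) = a := by omega
    have e2 : g (b / 2) = b := by omega
    rwa [e1, e2] at h8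

theorem pFun_le_iff {n : ℕ} {A B : Finset ℕ} {k j : ℕ} :
    pFun n A B k ≤ j ↔
      1 ≤ j ∧ ∀ i, 1 ≤ i → i ≤ n + 1 → i < k → i ∉ A → i - 1 ∈ B → i ≤ j := by
  simp only [pFun, Finset.max'_le_iff, Finset.mem_insert, Finset.mem_filter, Finset.mem_Icc,
    forall_eq_or_imp, and_imp]

theorem le_qFun_iff {n : ℕ} {A B : Finset ℕ} {k j : ℕ} :
    j ≤ qFun n A B k ↔
      j ≤ n + 1 ∧ ∀ i, 1 ≤ i → i ≤ n + 1 → k < i → i ∈ B → i - 1 ∉ A → j ≤ i := by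
  simp only [qFun, Finset.le_min'_iff, Finset.mem_insert, Finset.mem_filter, Finset.mem_Icc,
    forall_eq_or_imp, and_imp]

/-- `S(A,k)` stacked on top of a placement `S`. -/
def stack (n : ℕ) (A : Finset ℕ) (k : ℕ) (S : Finset (ℕ × ℕ)) : Finset (ℕ × ℕ) :=
  rowFinset n A k ∪ S.image fun p => (p.1 + 2, p.2)

theorem mem_stack {n : ℕ} {A : Finset ℕ} {k : ℕ} {S : Finset (ℕ × ℕ)} {a b : ℕ} :
    (a, b) ∈ stack n A k S ↔ InRow n A k a b ∨ 2 ≤ a ∧ (a - 2, b) ∈ S := by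
  simp only [stack, Finset.mem_union, mem_rowFinset, Finset.mem_image, Prod.mk.injEq, Prod.exists]
  refine or_congr_right ⟨?_, ?_⟩
  · rintro ⟨a', b', h, rfl, rfl⟩
    exact ⟨by omega, by simpa using h⟩
  · rintro ⟨h, h'⟩
    exact ⟨a - 2, b, h', by omega, rfl⟩

theorem add_two_mem_stack {n : ℕ} {A : Finset ℕ} {k : ℕ} {S : Finset (ℕ × ℕ)} {a b : ℕ} :
    (a + 2, b) ∈ stack n A k S ↔ (a, b) ∈ S := by
  simp [mem_stack, InRow]

theorem stack_injective (n : ℕ) (A : Finset ℕ) (k : ℕ) : Function.Injective (stack n A k) := by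
  intro S T h
  ext ⟨a, b⟩
  rw [← add_two_mem_stack (A := A) (n := n) (k := k), h, add_two_mem_stack]

theorem card_stack (n : ℕ) (A : Finset ℕ) (k : ℕ) (S : Finset (ℕ × ℕ)) :
    (stack n A k S).card = n + S.card := by
  rw [stack, Finset.card_union_of_disjoint, card_rowFinset, Finset.card_image_of_injective]
  · rintro ⟨a, b⟩ ⟨a', b'⟩ h
    simpa using h
  · rw [Finset.disjoint_left]
    rintro ⟨a, b⟩ h h'
    have := (mem_rowFinset.1 h).1
    simp only [Finset.mem_image, Prod.mk.injEq] at h'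
    omega

theorem InRow.eq_of_close {n : ℕ} {A : Finset ℕ} {k a b a' b' : ℕ} (h : InRow n A k a b)
    (h' : InRow n A k a' b') (h1 : b ≤ b' + 1) (h2 : b' ≤ b + 1) : a = a' ∧ b = b' := by
  obtain ⟨u1, u2, u3, u4⟩ := h
  obtain ⟨v1, v2, v3, v4⟩ := h'
  have e : b / 2 = b' / 2 := by omega
  rw [← e] at v3 v4
  have := u3.trans v3.symm
  omega

/-- Stacking `S(A,k)` on a placement with top `S(B,j)` is nonattacking exactly when `B ⊆ A` and
`p(A,B,k) ≤ j ≤ q(A,B,k)`. -/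
theorem peaceful_stack_iff {n : ℕ} {A B : Finset ℕ} {k j : ℕ} {S : Finset (ℕ × ℕ)}
    (hB : B ⊆ Finset.Icc 1 n) (hk : k ∈ Finset.Icc 1 (n + 1)) (hj : j ∈ Finset.Icc 1 (n + 1))
    (hS : Peaceful S) (htop : ∀ a b : ℕ, a < 2 → ((a, b) ∈ S ↔ InRow n B j a b)) :
    Peaceful (stack n A k S) ↔ B ⊆ A ∧ pFun n A B k ≤ j ∧ j ≤ qFun n A B k := by
  rw [Finset.mem_Icc] at hk hj
  constructor
  · intro hT
    have cross : ∀ i i', 1 ≤ i → i ≤ n → i ∉ A → i' ∈ B → ∃ b b', b / 2 + 1 = i ∧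
        b' / 2 + 1 = i' ∧ (b % 2 = 0 ↔ i < k) ∧ (b' % 2 = 0 ↔ i' < j) ∧
        ¬(b ≤ b' + 1 ∧ b' ≤ b + 1) := by
      intro i i' h1 h2 hi hi'
      have h3 := Finset.mem_Icc.1 (hB hi')
      obtain ⟨a, b, e, h⟩ := exists_inRow_block A k (show i - 1 < n by omega)
      obtain ⟨a', b', e', h'⟩ := exists_inRow_block B j (show i' - 1 < n by omega)
      obtain rfl : b / 2 + 1 = i := by omega
      obtain rfl : b' / 2 + 1 = i' := by omega
      refine ⟨b, b', rfl, rfl, h.2.2.2, h'.2.2.2, fun hbb => ?_⟩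
      have ha : a ≠ 0 := mt h.2.2.1.1 hi
      have ha' : a' = 0 := h'.2.2.1.2 hi'
      have ha2 := h.1
      have := hT a b (a' + 2) b' (mem_stack.2 (Or.inl h))
        (add_two_mem_stack.2 ((htop _ _ h'.1).2 h')) (by omega) (by omega) hbb.1 hbb.2
      omega
    refine ⟨fun i hi => ?_, pFun_le_iff.2 ⟨hj.1, fun i h1 h2 hik hiA hiB => ?_⟩,
      le_qFun_iff.2 ⟨hj.2, fun i h1 h2 hik hiB hiA => ?_⟩⟩
    · by_contra hiA
      have h3 := Finset.mem_Icc.1 (hB hi)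
      obtain ⟨b, b', h⟩ := cross i i h3.1 h3.2 hiA hi
      omega
    · have h3 := Finset.mem_Icc.1 (hB hiB)
      obtain ⟨b, b', h⟩ := cross i (i - 1) h1 (by omega) hiA hiB
      omega
    · have h3 := Finset.mem_Icc.1 (hB hiB)
      obtain ⟨b, b', h⟩ := cross (i - 1) i (by omega) (by omega) hiA hiB
      omega
  · rintro ⟨hBA, hp, hq⟩
    replace hp := (pFun_le_iff.1 hp).2
    replace hq := (le_qFun_iff.1 hq).2
    have cross : ∀ a b a' b', InRow n A k a b → 2 ≤ a' → (a' - 2, b') ∈ S → a' ≤ a + 1 →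
        b ≤ b' + 1 → b' ≤ b + 1 → False := by
      intro a b a' b' h ha' h' h1 h2 h3
      have ha := h.1
      have hr := (htop _ _ (by omega)).1 h'
      have hbA : b / 2 + 1 ∉ A := mt h.2.2.1.2 (by omega)
      have hbB : b' / 2 + 1 ∈ B := hr.2.2.1.1 (by omega)
      have hbA' := hBA hbB
      have hb1 := h.2.1
      have hb1' := hr.2.1
      have hc := h.2.2.2
      have hc' := hr.2.2.2
      have hne : b / 2 ≠ b' / 2 := fun e => hbA (e ▸ hbA')
      rcases Nat.lt_or_gt_of_ne hne with hlt | hlt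
      · have := hq (b' / 2 + 1) (by omega) (by omega) (by omega) hbB
          (by rwa [show b' / 2 + 1 - 1 = b / 2 + 1 by omega])
        omega
      · have := hp (b / 2 + 1) (by omega) (by omega) (by omega) hbA
          (by rwa [show b / 2 + 1 - 1 = b' / 2 + 1 by omega])
        omega
    intro a b a' b' h h' h1 h2 h3 h4
    rcases mem_stack.1 h with h | ⟨ha, h⟩ <;> rcases mem_stack.1 h' with h' | ⟨ha', h'⟩
    · exact h.eq_of_close h' h3 h4
    · exact (cross _ _ _ _ h ha' h' h2 h3 h4).elim
    · exact (cross _ _ _ _ h' ha h h1 h4 h3).elim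
    · have := hS _ _ _ _ h h' (by omega) (by omega) h3 h4
      omega

theorem stripPlacements_succ {n ℓ : ℕ} {A : Finset ℕ} {k : ℕ} (hl : 1 ≤ ℓ)
    (hA : A ⊆ Finset.Icc 1 n) (hk : k ∈ Finset.Icc 1 (n + 1)) :
    stripPlacements n (ℓ + 1) A k =
      ((A.powerset.sigma fun B => Finset.Icc (pFun n A B k) (qFun n A B k)).biUnion
        fun x => stripPlacements n ℓ x.1 x.2).image (stack n A k) := by
  ext T
  simp only [Finset.mem_image, Finset.mem_biUnion, Finset.mem_sigma, Finset.mem_powerset,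
    Finset.mem_Icc, mem_stripPlacements, Sigma.exists]
  constructor
  · rintro ⟨hb, hT, hc, htop⟩
    obtain ⟨S, rfl⟩ : ∃ S, stack n A k S = T := by
      refine ⟨(T.filter fun p => 2 ≤ p.1).image fun p => (p.1 - 2, p.2), ?_⟩
      ext ⟨a, b⟩
      simp only [mem_stack, Finset.mem_image, Finset.mem_filter, Prod.mk.injEq, Prod.exists]
      by_cases ha : a < 2
      · rw [htop a b ha]
        exact ⟨fun h => h.resolve_right (by omega), Or.inl⟩
      · constructor
        · rintro (h | ⟨-, a', b', ⟨h, h'⟩, e, rfl⟩)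
          · exact absurd h.1 ha
          · rwa [show a = a' by omega]
        · exact fun h => Or.inr ⟨by omega, a, b, ⟨h, by omega⟩, rfl, rfl⟩
    have hSb : ∀ a b, (a, b) ∈ S → a < 2 * ℓ ∧ b < 2 * n := by
      intro a b h
      have := hb _ _ (add_two_mem_stack.2 h)
      omega
    have hSp : Peaceful S := by
      intro a b a' b' h h' h1 h2 h3 h4
      have := hT _ _ _ _ (add_two_mem_stack.2 h) (add_two_mem_stack.2 h')
        (by omega) (by omega) h3 h4
      omega
    have hSc : S.card = ℓ * n := by
      rw [card_stack, Nat.succ_mul] at hc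
      omega
    obtain ⟨B, hB, j, hj, htop'⟩ := hSp.exists_inRow (fun a b h => (hSb a b h).2) fun c hc' => by
      obtain ⟨a, b, h, h1, h2⟩ := hSp.exists_mem_block hSb hSc (r := 0) (by omega) hc'
      exact ⟨a, b, h, by omega, h2⟩
    exact ⟨S, ⟨B, j, (peaceful_stack_iff hB hk hj hSp htop').1 hT, hSb, hSp, hSc, htop'⟩, rfl⟩
  · rintro ⟨S, ⟨B, j, ⟨hBA, hp, hq⟩, hSb, hSp, hSc, htop⟩, rfl⟩
    have hj : j ∈ Finset.Icc 1 (n + 1) :=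
      Finset.mem_Icc.2 ⟨(pFun_le_iff.1 hp).1, (le_qFun_iff.1 hq).1⟩
    refine ⟨?_, (peaceful_stack_iff (hBA.trans hA) hk hj hSp htop).2 ⟨hBA, hp, hq⟩, ?_, ?_⟩
    · intro a b h
      rcases mem_stack.1 h with h | ⟨h, h'⟩
      · exact ⟨by have := h.1; omega, h.2.1⟩
      · have := hSb _ _ h'
        omega
    · rw [card_stack, hSc, Nat.succ_mul, Nat.add_comm]
    · intro a b ha
      rw [mem_stack]
      exact ⟨fun h => h.resolve_right (by omega), Or.inl⟩

theorem stripPlacements_one (n : ℕ) (A : Finset ℕ) (k : ℕ) :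
    stripPlacements n 1 A k = {rowFinset n A k} := by
  ext S
  rw [mem_stripPlacements, Finset.mem_singleton]
  constructor
  · rintro ⟨hb, -, -, htop⟩
    ext ⟨a, b⟩
    rw [mem_rowFinset]
    exact ⟨fun h => (htop a b (hb a b h).1).1 h, fun h => (htop a b h.1).2 h⟩
  · rintro rfl
    refine ⟨fun a b h => ?_, fun a b a' b' h h' _ _ => ?_, by simp [card_rowFinset],
      fun a b _ => mem_rowFinset⟩
    · rw [mem_rowFinset] at h
      exact ⟨h.1, h.2.1⟩
    · exact (mem_rowFinset.1 h).eq_of_close (mem_rowFinset.1 h')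

theorem mEnt_eq_card_stripPlacements (n ℓ : ℕ) {A : Finset ℕ} (hA : A ⊆ Finset.Icc 1 n) {k : ℕ}
    (hk : k ∈ Finset.Icc 1 (n + 1)) :
    mEnt n (ℓ + 1) A k = (stripPlacements n (ℓ + 1) A k).card := by
  induction ℓ generalizing A k with
  | zero => simp [stripPlacements_one, mEnt]
  | succ ℓ ih =>
    have hmem : ∀ x ∈ A.powerset.sigma fun B => Finset.Icc (pFun n A B k) (qFun n A B k),
        x.1 ⊆ Finset.Icc 1 n ∧ x.2 ∈ Finset.Icc 1 (n + 1) := by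
      rintro ⟨B, j⟩ h
      simp only [Finset.mem_sigma, Finset.mem_powerset, Finset.mem_Icc] at h
      exact ⟨h.1.trans hA, Finset.mem_Icc.2 ⟨(pFun_le_iff.1 h.2.1).1, (le_qFun_iff.1 h.2.2).1⟩⟩
    rw [stripPlacements_succ (by omega) hA hk,
      Finset.card_image_of_injective _ (stack_injective n A k), Finset.card_biUnion]
    · rw [mEnt, Finset.sum_sigma']
      exact Finset.sum_congr rfl fun x hx => ih (hmem x hx).1 (hmem x hx).2
    · rintro ⟨B, j⟩ hx ⟨B', j'⟩ hy hne
      rw [Function.onFun, Finset.disjoint_left]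
      intro S hS hS'
      apply hne
      obtain ⟨rfl, rfl⟩ := InRow.unique (hmem _ hx).1 (hmem _ hy).1 (hmem _ hx).2 (hmem _ hy).2
        fun a b ha => ((mem_stripPlacements.1 hS).2.2.2 a b ha).symm.trans
          ((mem_stripPlacements.1 hS').2.2.2 a b ha)
      rfl

theorem mem_kingPlacement_iff {n : ℕ} {A : Finset ℕ} {k : ℕ} (p : Fin 2 × Fin (2 * n)) :
    p ∈ kingPlacement n A k ↔ InRow n A k p.1 p.2 := by
  obtain ⟨⟨a, ha⟩, ⟨b, hb⟩⟩ := p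
  simp only [kingPlacement, kingPred, Finset.mem_filter, Finset.mem_univ, true_and, InRow,
    Finset.mem_Icc]
  constructor
  · rintro ⟨i, ⟨h1, h2⟩, h3, h4⟩
    have e : b / 2 + 1 = i := by split_ifs at h4 <;> omega
    rw [e]
    refine ⟨ha, hb, ?_, ?_⟩
    · rw [h3]; split_ifs with h <;> simp [h]
    · split_ifs at h4 <;> omega
  · rintro ⟨-, -, h3, h4⟩
    refine ⟨b / 2 + 1, by omega, ?_, ?_⟩
    · split_ifs with h
      · exact h3.2 h
      · have := mt h3.1 h
        omega
    · split_ifs <;> omega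

/-- Forgetting the bounds on the coordinates. -/
def finPairEmbedding (m n : ℕ) : Fin m × Fin n ↪ ℕ × ℕ :=
  Fin.valEmbedding.prodMap Fin.valEmbedding

theorem mem_map_finPairEmbedding {m n : ℕ} {S : Finset (Fin m × Fin n)} {a b : ℕ} :
    (a, b) ∈ S.map (finPairEmbedding m n) ↔ ∃ q ∈ S, (q.1 : ℕ) = a ∧ (q.2 : ℕ) = b := by
  simp [finPairEmbedding]

theorem peaceful_map_iff {m n : ℕ} {S : Finset (Fin m × Fin n)} :
    Peaceful (S.map (finPairEmbedding m n)) ↔ Nonattacking S := by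
  simp only [Peaceful, mem_map_finPairEmbedding, Nonattacking]
  constructor
  · intro h p hp q hq hne
    by_contra hlt
    apply hne
    simp only [Nat.dist] at hlt
    have := h _ _ _ _ ⟨p, hp, rfl, rfl⟩ ⟨q, hq, rfl, rfl⟩ (by omega) (by omega) (by omega)
      (by omega)
    exact Prod.ext (Fin.ext this.1) (Fin.ext this.2)
  · rintro h _ _ _ _ ⟨p, hp, rfl, rfl⟩ ⟨q, hq, rfl, rfl⟩ h1 h2 h3 h4
    by_contra hne
    have := h p hp q hq (by rintro rfl; exact hne ⟨rfl, rfl⟩)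
    simp only [Nat.dist] at this
    omega

/-- `m^ℓ_{A,k}` counts the nonattacking placements of `ℓn` kings on the `2ℓ × 2n`
strip whose restriction to the top two rows is exactly `S(A,k)`. -/
theorem mEnt_counts (n : ℕ) (hn : 1 ≤ n) (ℓ : ℕ) (hl : 1 ≤ ℓ) (hln : ℓ ≤ n)
    (A : Finset ℕ) (hA : A ⊆ Finset.Icc 1 n) (k : ℕ) (hk : k ∈ Finset.Icc 1 (n + 1)) :
    mEnt n ℓ A k =
      Set.ncard {S : Finset (Fin (2 * ℓ) × Fin (2 * n)) |
        Nonattacking S ∧ S.card = ℓ * n ∧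
        ∀ p : Fin 2 × Fin (2 * n), p ∈ kingPlacement n A k ↔
          ∃ q ∈ S, (q.1 : ℕ) = (p.1 : ℕ) ∧ (q.2 : ℕ) = (p.2 : ℕ)} := by
  obtain ⟨ℓ, rfl⟩ : ∃ r, ℓ = r + 1 := ⟨ℓ - 1, by omega⟩
  rw [mEnt_eq_card_stripPlacements n ℓ hA hk, ← Set.ncard_coe_finset,
    ← Set.ncard_image_of_injective _ (Finset.map_injective (finPairEmbedding _ _))]
  congr 1
  ext T
  simp only [Finset.mem_coe, mem_stripPlacements, Set.mem_image, Set.mem_ofPred_eq]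
  constructor
  · rintro ⟨hb, hT, hc, htop⟩
    obtain ⟨S, rfl⟩ : ∃ S : Finset _, S.map (finPairEmbedding (2 * (ℓ + 1)) (2 * n)) = T := by
      refine ⟨Finset.univ.filter fun q => ((q.1 : ℕ), (q.2 : ℕ)) ∈ T, ?_⟩
      ext ⟨a, b⟩
      simp only [mem_map_finPairEmbedding, Finset.mem_filter, Finset.mem_univ, true_and]
      constructor
      · rintro ⟨q, hq, rfl, rfl⟩
        exact hq
      · intro h
        exact ⟨(⟨a, (hb a b h).1⟩, ⟨b, (hb a b h).2⟩), h, rfl, rfl⟩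
    refine ⟨S, ⟨peaceful_map_iff.1 hT, by simpa using hc, fun p => ?_⟩, rfl⟩
    rw [mem_kingPlacement_iff, ← htop _ _ p.1.isLt, mem_map_finPairEmbedding]
  · rintro ⟨S, ⟨hS, hc, htop⟩, rfl⟩
    refine ⟨?_, peaceful_map_iff.2 hS, by simpa using hc, fun a b ha => ?_⟩
    · intro a b h
      obtain ⟨q, -, rfl, rfl⟩ := mem_map_finPairEmbedding.1 h
      exact ⟨q.1.isLt, q.2.isLt⟩
    · by_cases hb : b < 2 * n
      · rw [mem_map_finPairEmbedding, ← htop (⟨a, ha⟩, ⟨b, hb⟩), mem_kingPlacement_iff]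
      · refine iff_of_false (fun h => ?_) fun h => hb h.2.1
        obtain ⟨q, -, rfl, rfl⟩ := mem_map_finPairEmbedding.1 h
        exact hb q.2.isLt
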